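/- Consider a finite two-agent Markov game with state set S, action sets A_P and A_A, reward r, transition kernel P, discount γ ∈ [0,1), and fixed stationary stochastic policies π^P, π^A, with associated operator (MQ)(s,a_P,a_A) = r(s,a_P,a_A) + γ·∑_{s'} P(s'|s,a_P,a_A)·∑_{b_P,b_A} π^P(s')(b_P)·π^A(s')(b_A)·Q(s',b_P,b_A). Let u : ℝ → ℝ satisfy the slope condition with constants 0 < ε₀ ≤ L, let x₀ ∈ ℝ, and let 0 < α ≤ min(1/L, 1). Define the risk-sensitive operator H on joint Q-functions by (HQ)(s,a_P,a_A) = α·( u( (MQ)(s,a_P,a_A) − Q(s,a_P,a_A) ) − x₀ ) + Q(s,a_P,a_A). Then H is a contraction in the sup-norm with modulus 1 − αε₀(1−γ): ‖HQ − HQ'‖_∞ ≤ (1 − αε₀(1−γ))·‖Q − Q'‖_∞ for all Q, Q'. -/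

import Mathlib

open Finset

/-- Sup-norm on joint Q-functions over a finite state and joint-action space. -/
noncomputable def supNormQ2 {S AP AA : Type} [Fintype S] [Fintype AP] [Fintype AA]
    [Nonempty S] [Nonempty AP] [Nonempty AA]
    (f : S → AP → AA → ℝ) : ℝ :=
  ⨆ p : S × AP × AA, |f p.1 p.2.1 p.2.2|

/-- `u` has slopes between `ε₀` and `L`. -/
def SlopeCondition (u : ℝ → ℝ) (ε₀ L : ℝ) : Prop :=
  ∀ x y : ℝ, x ≠ y → ε₀ ≤ (u x - u y) / (x - y) ∧ (u x - u y) / (x - y) ≤ L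

/-- The policy-evaluation operator
`(MQ)(s,a_P,a_A) = r(s,a_P,a_A) + γ·∑_{s'} P(s'|s,a_P,a_A)·∑_{b_P,b_A} π^P(s')(b_P)·π^A(s')(b_A)·Q(s',b_P,b_A)`. -/
noncomputable def jointEvalOp {S AP AA : Type} [Fintype S] [Fintype AP] [Fintype AA]
    (r : S → AP → AA → ℝ) (P : S → AP → AA → S → ℝ) (γ : ℝ)
    (πP : S → AP → ℝ) (πA : S → AA → ℝ)
    (Q : S → AP → AA → ℝ) : S → AP → AA → ℝ :=
  fun s aP aA =>
    r s aP aA + γ * ∑ s', P s aP aA s' *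
      ∑ bP, ∑ bA, πP s' bP * πA s' bA * Q s' bP bA

/-- The risk-sensitive operator
`(HQ)(s,a_P,a_A) = α·(u((MQ)(s,a_P,a_A) − Q(s,a_P,a_A)) − x₀) + Q(s,a_P,a_A)`. -/
noncomputable def riskEvalOp {S AP AA : Type} [Fintype S] [Fintype AP] [Fintype AA]
    (r : S → AP → AA → ℝ) (P : S → AP → AA → S → ℝ) (γ : ℝ)
    (πP : S → AP → ℝ) (πA : S → AA → ℝ) (u : ℝ → ℝ) (x₀ α : ℝ)
    (Q : S → AP → AA → ℝ) : S → AP → AA → ℝ :=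
  fun s aP aA =>
    α * (u (jointEvalOp r P γ πP πA Q s aP aA - Q s aP aA) - x₀) + Q s aP aA

theorem abs_apply_le_supNormQ2 {S AP AA : Type} [Fintype S] [Fintype AP] [Fintype AA]
    [Nonempty S] [Nonempty AP] [Nonempty AA] (f : S → AP → AA → ℝ) (s : S) (aP : AP) (aA : AA) :
    |f s aP aA| ≤ supNormQ2 f :=
  le_ciSup (f := fun p : S × AP × AA => |f p.1 p.2.1 p.2.2|) (Set.finite_range _).bddAbove
    (s, aP, aA)

/-- A weighted average of numbers bounded by `D` in absolute value is bounded by `D`. -/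
theorem abs_sum_mul_le_of_sum_eq_one {ι : Type*} [Fintype ι] {w f : ι → ℝ} {D : ℝ}
    (hw : ∀ i, 0 ≤ w i) (hw_sum : ∑ i, w i = 1) (hf : ∀ i, |f i| ≤ D) :
    |∑ i, w i * f i| ≤ D :=
  calc |∑ i, w i * f i| ≤ ∑ i, |w i * f i| := abs_sum_le_sum_abs _ _
    _ ≤ ∑ i, w i * D := sum_le_sum fun i _ => by
        rw [abs_mul, abs_of_nonneg (hw i)]
        exact mul_le_mul_of_nonneg_left (hf i) (hw i)
    _ = D := by rw [← sum_mul, hw_sum, one_mul]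

/-- The policy-evaluation operator is `γ`-Lipschitz in the sup-norm. -/
theorem abs_jointEvalOp_sub_le {S AP AA : Type} [Fintype S] [Fintype AP] [Fintype AA]
    {r : S → AP → AA → ℝ} {P : S → AP → AA → S → ℝ}
    (hP_nonneg : ∀ s aP aA s', 0 ≤ P s aP aA s')
    (hP_sum : ∀ s aP aA, ∑ s', P s aP aA s' = 1)
    {γ : ℝ} (hγ0 : 0 ≤ γ) {πP : S → AP → ℝ} {πA : S → AA → ℝ}
    (hπP_nonneg : ∀ s' bP, 0 ≤ πP s' bP) (hπP_sum : ∀ s', ∑ bP, πP s' bP = 1)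
    (hπA_nonneg : ∀ s' bA, 0 ≤ πA s' bA) (hπA_sum : ∀ s', ∑ bA, πA s' bA = 1)
    {Q Q' : S → AP → AA → ℝ} {D : ℝ} (hD : ∀ s aP aA, |Q s aP aA - Q' s aP aA| ≤ D)
    (s : S) (aP : AP) (aA : AA) :
    |jointEvalOp r P γ πP πA Q s aP aA - jointEvalOp r P γ πP πA Q' s aP aA| ≤ γ * D := by
  have hsub : jointEvalOp r P γ πP πA Q s aP aA - jointEvalOp r P γ πP πA Q' s aP aA =
      γ * ∑ s', P s aP aA s' *
        ∑ bP, πP s' bP * ∑ bA, πA s' bA * (Q s' bP bA - Q' s' bP bA) := by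
    simp only [jointEvalOp, mul_sub, sum_sub_distrib, mul_sum, mul_assoc]
    ring
  rw [hsub, abs_mul, abs_of_nonneg hγ0]
  refine mul_le_mul_of_nonneg_left ?_ hγ0
  exact abs_sum_mul_le_of_sum_eq_one (hP_nonneg s aP aA) (hP_sum s aP aA) fun s' =>
    abs_sum_mul_le_of_sum_eq_one (hπP_nonneg s') (hπP_sum s') fun bP =>
      abs_sum_mul_le_of_sum_eq_one (hπA_nonneg s') (hπA_sum s') fun bA => hD s' bP bA

/-- A difference of values of `u` is a slope in `[ε₀, L]` times the difference of arguments. -/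
theorem SlopeCondition.exists_slope {u : ℝ → ℝ} {ε₀ L : ℝ} (hu : SlopeCondition u ε₀ L)
    (hε₀L : ε₀ ≤ L) (x y : ℝ) : ∃ ξ, ε₀ ≤ ξ ∧ ξ ≤ L ∧ u x - u y = ξ * (x - y) := by
  rcases eq_or_ne x y with rfl | hxy
  · exact ⟨ε₀, le_rfl, hε₀L, by simp⟩
  · exact ⟨_, (hu x y hxy).1, (hu x y hxy).2, (div_mul_cancel₀ _ (sub_ne_zero.2 hxy)).symm⟩

/-- The risk-sensitive policy-evaluation operator `H` is a sup-norm
contraction with modulus `1 − αε₀(1−γ)`. -/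
theorem riskEvalOp_contraction
    {S AP AA : Type} [Fintype S] [Fintype AP] [Fintype AA]
    [Nonempty S] [Nonempty AP] [Nonempty AA]
    (r : S → AP → AA → ℝ) (P : S → AP → AA → S → ℝ)
    (hP_nonneg : ∀ s aP aA s', 0 ≤ P s aP aA s')
    (hP_sum : ∀ s aP aA, ∑ s', P s aP aA s' = 1)
    (γ : ℝ) (hγ0 : 0 ≤ γ) (hγ1 : γ < 1)
    (πP : S → AP → ℝ) (πA : S → AA → ℝ)
    (hπP_nonneg : ∀ s' bP, 0 ≤ πP s' bP) (hπP_sum : ∀ s', ∑ bP, πP s' bP = 1)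
    (hπA_nonneg : ∀ s' bA, 0 ≤ πA s' bA) (hπA_sum : ∀ s', ∑ bA, πA s' bA = 1)
    (u : ℝ → ℝ) (ε₀ L : ℝ) (hε₀ : 0 < ε₀) (hε₀L : ε₀ ≤ L)
    (hu : SlopeCondition u ε₀ L)
    (x₀ : ℝ) (α : ℝ) (hα0 : 0 < α) (hα1 : α ≤ min (1 / L) 1) :
    ∀ Q Q' : S → AP → AA → ℝ,
      supNormQ2 (fun s aP aA =>
          riskEvalOp r P γ πP πA u x₀ α Q s aP aA
            - riskEvalOp r P γ πP πA u x₀ α Q' s aP aA)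
        ≤ (1 - α * ε₀ * (1 - γ)) * supNormQ2 (fun s aP aA => Q s aP aA - Q' s aP aA) := by
  intro Q Q'
  refine ciSup_le fun ⟨s, aP, aA⟩ => ?_
  have hD := abs_apply_le_supNormQ2 fun s aP aA => Q s aP aA - Q' s aP aA
  set D := supNormQ2 fun s aP aA => Q s aP aA - Q' s aP aA
  have hD0 : 0 ≤ D := (abs_nonneg _).trans (hD s aP aA)
  have hM := abs_jointEvalOp_sub_le (r := r) hP_nonneg hP_sum hγ0 hπP_nonneg hπP_sum
    hπA_nonneg hπA_sum hD s aP aA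
  have hd := hD s aP aA
  simp only [riskEvalOp]
  set m := jointEvalOp r P γ πP πA Q s aP aA
  set m' := jointEvalOp r P γ πP πA Q' s aP aA
  set q := Q s aP aA
  set q' := Q' s aP aA
  obtain ⟨ξ, hξ₀, hξL, hξ⟩ := hu.exists_slope hε₀L (m - q) (m' - q')
  have hαL : α * L ≤ 1 := (le_div_iff₀ (hε₀.trans_le hε₀L)).1 (hα1.trans (min_le_left _ _))
  have hαξ0 : 0 ≤ α * ξ := mul_nonneg hα0.le (hε₀.le.trans hξ₀)
  have hαξ1 : 0 ≤ 1 - α * ξ := sub_nonneg.2 ((mul_le_mul_of_nonneg_left hξL hα0.le).trans hαL)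
  calc |α * (u (m - q) - x₀) + q - (α * (u (m' - q') - x₀) + q')|
      = |α * ξ * (m - m') + (1 - α * ξ) * (q - q')| := by
        congr 1
        linear_combination α * hξ
    _ ≤ |α * ξ * (m - m')| + |(1 - α * ξ) * (q - q')| := abs_add_le _ _
    _ = α * ξ * |m - m'| + (1 - α * ξ) * |q - q'| := by
        rw [abs_mul (α * ξ), abs_mul (1 - α * ξ), abs_of_nonneg hαξ0, abs_of_nonneg hαξ1]
    _ ≤ α * ξ * (γ * D) + (1 - α * ξ) * D := by gcongr
    _ = (1 - α * ξ * (1 - γ)) * D := by ring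
    _ ≤ (1 - α * ε₀ * (1 - γ)) * D := by
        have : 0 ≤ 1 - γ := sub_nonneg.2 hγ1.le
        gcongr
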